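/- arXiv:2504.15569 — 2 statements merged into one kernel-verified Lean document; each statement's English description precedes it below -/
import Mathlib

section
/- Let p be a prime, let R be a reduced, F-finite local commutative ring of characteristic p that is F-split, and let 𝔞 ⊆ R be an ideal. Then the following are equivalent: (i) 𝔞 is uniformly compatible, i.e., for every e ≥ 1 and every p^{-e}-linear map φ: R → R one has φ(a) ∈ 𝔞 for all a ∈ 𝔞; (ii) for every R-linear map ψ: R_perf → R one has ψ(a^{1/p^e}) ∈ 𝔞 for all a ∈ 𝔞 and all e ≥ 0. -/
/-- The perfection `R_perf = PerfectClosure R p` is an `R`-algebra via the canonical map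
`R → R_perf`, hence an `R`-module. -/
noncomputable instance PerfectClosure.algebraOf (R : Type*) [CommRing R] (p : ℕ)
    [Fact p.Prime] [CharP R p] : Algebra R (PerfectClosure R p) :=
  (PerfectClosure.of R p).toAlgebra

/-- Evaluating an `R`-linear map `R_perf → R` on `p ^ e`-th roots gives a `p^{-e}`-linear map. -/
noncomputable def PerfectClosure.restrictRoots {R : Type*} [CommRing R] {p : ℕ} [Fact p.Prime]
    [CharP R p]
    (ψ : PerfectClosure R p →ₗ[R] R) (e : ℕ) : R →+ R where
  toFun x := ψ (PerfectClosure.mk R p (e, x))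
  map_zero' := by simp
  map_add' x y := by
    rw [← map_add]
    congr 1
    rw [PerfectClosure.mk_add_mk, PerfectClosure.mk_eq_iff]
    exact ⟨0, by simp [iterate_map_add, ← Function.iterate_add_apply]⟩

theorem PerfectClosure.smul_mk {R : Type*} [CommRing R] {p : ℕ} [Fact p.Prime] [CharP R p]
    (r x : R) (n : ℕ) :
    r • PerfectClosure.mk R p (n, x) = PerfectClosure.mk R p (n, r ^ p ^ n * x) := by
  rw [Algebra.smul_def]
  change PerfectClosure.mk R p (0, r) * PerfectClosure.mk R p (n, x) = _
  simp [iterate_frobenius]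

theorem iterate_pow_mul_of_frobenius_inverse_linear {R : Type*} [CommRing R] {p : ℕ} {σ : R →+ R}
    (hσ : ∀ r x : R, σ (r ^ p * x) = r * σ x) (n : ℕ) (r x : R) :
    σ^[n] (r ^ p ^ n * x) = r * σ^[n] x := by
  induction n generalizing x with
  | zero => simp
  | succ n ih => rw [Function.iterate_succ_apply, pow_succ, pow_mul, hσ, ih,
      Function.iterate_succ_apply]

theorem iterate_pow_of_frobenius_splitting {R : Type*} [CommRing R] {p : ℕ} {σ : R →+ R}
    (hσ : ∀ r x : R, σ (r ^ p * x) = r * σ x) (hσ1 : σ 1 = 1) (n : ℕ) (r : R) :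
    σ^[n] (r ^ p ^ n) = r := by
  simpa [Function.iterate_fixed hσ1 n] using
    iterate_pow_mul_of_frobenius_inverse_linear hσ n r 1

/-- A Frobenius splitting `σ` extends a `p^{-e}`-linear map `φ` to an `R`-linear map `R_perf → R`,
by retracting `x ^ (1 / p ^ n) = (x ^ (p ^ e)) ^ (1 / p ^ (n + e))` to the `e`-th stage. -/
noncomputable def PerfectClosure.extendOfSplitting {R : Type*} [CommRing R] {p : ℕ} [Fact p.Prime]
    [CharP R p]
    (σ : R →+ R) (hσ : ∀ r x : R, σ (r ^ p * x) = r * σ x) (hσ1 : σ 1 = 1)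
    (e : ℕ) (φ : R →+ R) (hφ : ∀ r x : R, φ (r ^ p ^ e * x) = r * φ x) :
    PerfectClosure R p →ₗ[R] R where
  toFun z := z.liftOn (fun q => φ (σ^[q.1] (q.2 ^ p ^ e))) (by
    rintro _ _ ⟨n, x⟩
    have h := hσ (x ^ p ^ e) 1
    rw [mul_one, hσ1, mul_one] at h
    simp only [frobenius_def]
    rw [Function.iterate_succ_apply, ← pow_mul, mul_comm p, pow_mul, h])
  map_add' z w := by
    induction z using PerfectClosure.induction_on with | h z => ?_
    induction w using PerfectClosure.induction_on with | h w => ?_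
    obtain ⟨m, x⟩ := z
    obtain ⟨n, y⟩ := w
    simp only [PerfectClosure.mk_add_mk, PerfectClosure.liftOn_mk, iterate_frobenius]
    rw [add_pow_char_pow, iterate_map_add, map_add]
    congr 2
    · rw [Function.iterate_add_apply, pow_right_comm,
        iterate_pow_of_frobenius_splitting hσ hσ1]
    · rw [add_comm m n, Function.iterate_add_apply, pow_right_comm,
        iterate_pow_of_frobenius_splitting hσ hσ1]
  map_smul' r z := by
    induction z using PerfectClosure.induction_on with | h z => ?_
    obtain ⟨n, x⟩ := z
    simp only [PerfectClosure.smul_mk, PerfectClosure.liftOn_mk, RingHom.id_apply, smul_eq_mul]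
    rw [mul_pow, pow_right_comm, iterate_pow_mul_of_frobenius_inverse_linear hσ, hφ]

theorem PerfectClosure.extendOfSplitting_mk {R : Type*} [CommRing R] {p : ℕ} [Fact p.Prime]
    [CharP R p] (σ : R →+ R) (hσ : ∀ r x : R, σ (r ^ p * x) = r * σ x) (hσ1 : σ 1 = 1)
    (e : ℕ) (φ : R →+ R) (hφ : ∀ r x : R, φ (r ^ p ^ e * x) = r * φ x) (x : R) :
    PerfectClosure.extendOfSplitting σ hσ hσ1 e φ hφ (PerfectClosure.mk R p (e, x)) = φ x := by
  change φ (σ^[e] (x ^ p ^ e)) = φ x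
  rw [iterate_pow_of_frobenius_splitting hσ hσ1]

/-- Let `p` be a prime, `R` a reduced, F-finite local commutative ring of characteristic `p`
which is F-split, and `𝔞 ⊆ R` an ideal.  The following are equivalent:
(i) `𝔞` is uniformly compatible: for every `e ≥ 1` and every `p^{-e}`-linear map `φ : R → R`
one has `φ a ∈ 𝔞` for all `a ∈ 𝔞`;
(ii) for every `R`-linear map `ψ : R_perf → R` one has `ψ (a ^ (1 / p ^ e)) ∈ 𝔞` for all
`a ∈ 𝔞` and all `e ≥ 0`. -/
theorem uniformly_compatible_iff_compatible_with_perfection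
    (p : ℕ) [Fact p.Prime] (R : Type*) [CommRing R] [CharP R p]
    [IsReduced R] [IsLocalRing R]
    [Module.Finite (RingHom.range (frobenius R p)) R]
    (σ : R →+ R) (hσ : ∀ r x : R, σ (r ^ p * x) = r * σ x) (hσ1 : σ 1 = 1)
    (𝔞 : Ideal R) :
    (∀ e : ℕ, 1 ≤ e → ∀ φ : R →+ R, (∀ r x : R, φ (r ^ p ^ e * x) = r * φ x) →
      ∀ a ∈ 𝔞, φ a ∈ 𝔞) ↔
    (∀ ψ : PerfectClosure R p →ₗ[R] R, ∀ a ∈ 𝔞, ∀ e : ℕ,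
      ψ (PerfectClosure.mk R p (e, a)) ∈ 𝔞) := by
  constructor
  · intro h ψ a ha e
    rcases Nat.eq_zero_or_pos e with rfl | he
    · have h1 : PerfectClosure.mk R p (0, a) = a • PerfectClosure.mk R p (0, 1) := by
        simp [PerfectClosure.smul_mk]
      rw [h1, map_smul, smul_eq_mul]
      exact 𝔞.mul_mem_right _ ha
    · refine h e he (PerfectClosure.restrictRoots ψ e) (fun r x => ?_) a ha
      change ψ _ = r * ψ _
      rw [← PerfectClosure.smul_mk, map_smul, smul_eq_mul]
  · intro h e _ φ hφ a ha
    rw [← PerfectClosure.extendOfSplitting_mk σ hσ hσ1 e φ hφ a]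
    exact h _ a ha e
end

section
/- Let (R, m) be a Noetherian local ring whose residue field has characteristic p > 0, let B be an R-algebra and let x ∈ B. Then the R-module map R → B sending 1 to x is pure if and only if the induced map R̂ → B̂ between the m-adic completions, sending 1 to the image of x, is a pure map of R̂-modules. -/
universe u

/-- A map of `R`-modules is pure if it stays injective after tensoring with any `R`-module. -/
def IsPureMap (R : Type u) [CommRing R] {M N : Type u} [AddCommGroup M] [Module R M]
    [AddCommGroup N] [Module R N] (f : M →ₗ[R] N) : Prop :=
  ∀ (E : Type u) [AddCommGroup E] [Module R E], Function.Injective (LinearMap.rTensor E f)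

open IsLocalRing TensorProduct

/-- An element of `N ⊗ E` of the form `y ⊗ u` that vanishes already vanishes in `N ⊗ Q` for a
finitely generated submodule `Q` of `E` containing `u`. -/
theorem exists_fg_tmul_eq_zero {R N E : Type*} [CommRing R] [AddCommGroup N] [Module R N]
    [AddCommGroup E] [Module R E] {y : N} {u : E} (h : y ⊗ₜ[R] u = 0) :
    ∃ (Q : Submodule R E) (hu : u ∈ Q), Q.FG ∧ y ⊗ₜ[R] (⟨u, hu⟩ : Q) = 0 := by
  have hP : (Submodule.span R {u}).FG := Submodule.fg_span_singleton u
  have h' : LinearMap.rTensor N (Submodule.span R {u}).subtype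
      ((⟨u, Submodule.mem_span_singleton_self u⟩ : Submodule.span R {u}) ⊗ₜ[R] y) = 0 := by
    simpa using congrArg (TensorProduct.comm R N E) h
  obtain ⟨Q, hPQ, hQ, hz⟩ := TensorProduct.eq_zero_of_fg_of_subtype_eq_zero hP h'
  exact ⟨Q, hPQ (Submodule.mem_span_singleton_self u), hQ,
    congrArg (TensorProduct.comm R Q N) hz |>.trans (map_zero _)⟩

/-- A map out of `R` is pure if and only if no nonzero `u` in an `R`-module `E` is killed by
tensoring with the image of `1`. -/
theorem isPureMap_iff_tmul_eq_zero {R N : Type u} [CommRing R] [AddCommGroup N] [Module R N]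
    (f : R →ₗ[R] N) :
    IsPureMap R f ↔ ∀ (E : Type u) [AddCommGroup E] [Module R E] (u : E),
      f 1 ⊗ₜ[R] u = 0 → u = 0 := by
  refine forall_congr' fun E ↦ forall_congr' fun _ ↦ forall_congr' fun _ ↦ ?_
  rw [injective_iff_map_eq_zero]
  refine ⟨fun h u hu ↦ ?_, fun h z hz ↦ ?_⟩
  · simpa using congrArg (TensorProduct.lid R E) (h (1 ⊗ₜ u) (by simpa using hu))
  · obtain ⟨u, rfl⟩ := (TensorProduct.lid R E).symm.surjective z
    rw [TensorProduct.lid_symm_apply] at hz ⊢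
    rw [h u (by simpa using hz), TensorProduct.tmul_zero]

/-- Over a Noetherian local ring, purity of a map out of the ring can be tested on modules killed
by a power of the maximal ideal. -/
theorem isPureMap_of_pow_maximalIdeal_smul_eq_bot {R N : Type u} [CommRing R] [IsNoetherianRing R]
    [IsLocalRing R] [AddCommGroup N] [Module R N] (f : R →ₗ[R] N)
    (h : ∀ (E : Type u) [AddCommGroup E] [Module R E] (n : ℕ),
      maximalIdeal R ^ n • (⊤ : Submodule R E) = ⊥ → ∀ u : E, f 1 ⊗ₜ[R] u = 0 → u = 0) :
    IsPureMap R f := by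
  rw [isPureMap_iff_tmul_eq_zero]
  intro E _ _ u hu
  obtain ⟨Q, huQ, hQ, hz⟩ := exists_fg_tmul_eq_zero hu
  have : Module.Finite R Q := Module.Finite.of_fg hQ
  suffices (⟨u, huQ⟩ : Q) = 0 from congrArg Subtype.val this
  have hK := Ideal.iInf_pow_smul_eq_bot_of_isLocalRing (M := Q) (maximalIdeal R)
    (maximalIdeal.isMaximal R).ne_top
  rw [← Submodule.mem_bot R, ← hK, Submodule.mem_iInf]
  intro n
  rw [← Submodule.Quotient.mk_eq_zero]
  refine h _ n ?_ _ ?_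
  · rw [eq_bot_iff, Submodule.smul_le]
    rintro r hr q -
    obtain ⟨q, rfl⟩ := Submodule.Quotient.mk_surjective _ q
    rw [Submodule.mem_bot, ← Submodule.Quotient.mk_smul, Submodule.Quotient.mk_eq_zero]
    exact Submodule.smul_mem_smul hr trivial
  · simpa using congrArg (LinearMap.lTensor N (Submodule.mkQ
      (maximalIdeal R ^ n • (⊤ : Submodule R Q)))) hz

/-- The adic completion of a Noetherian ring is Noetherian. -/
instance AdicCompletion.isNoetherianRing {R : Type*} [CommRing R] [IsNoetherianRing R]
    (I : Ideal R) : IsNoetherianRing (AdicCompletion I R) := by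
  obtain ⟨s, hs⟩ := I.fg_of_isNoetherianRing
  let J := MvPolynomial.idealOfVars s R
  let φ : MvPolynomial s R →+* R := MvPolynomial.eval Subtype.val
  have hφ : J.map φ = I := by
    rw [Ideal.map_span, ← Set.range_comp, ← hs]
    congr 1
    ext; simp [φ]
  have hle (n : ℕ) : J ^ n ≤ (I ^ n).comap φ := by
    rw [← Ideal.map_le_iff_le_comap, Ideal.map_pow, hφ]
  let F : MvPowerSeries s R →+* AdicCompletion I R := AdicCompletion.liftRingHom I
    (fun n ↦ (Ideal.quotientMap (I ^ n) φ (hle n)).comp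
      (MvPowerSeries.truncTotalAlgHom s R n).toRingHom) (by
    intro m n hmn
    ext p
    change Ideal.Quotient.mk (I ^ m) (φ _) = Ideal.Quotient.mk (I ^ m) (φ _)
    rw [Ideal.Quotient.eq, ← map_sub]
    exact hle m (MvPowerSeries.truncTotal_sub_truncTotal_mem_pow_idealOfVars hmn le_rfl p))
  have hF (p : MvPolynomial s R) : F p = algebraMap R _ (φ p) := by
    refine AdicCompletion.ext_evalₐ fun n ↦ ?_
    rw [AdicCompletion.evalₐ_liftRingHom, AlgHom.commutes]
    exact congrArg (Ideal.quotientMap (I ^ n) φ (hle n))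
      ((MvPowerSeries.truncTotalAlgHom s R n).commutes p)
  have hmap : (Ideal.span (Set.range MvPowerSeries.X)).map F =
      I.map (algebraMap R (AdicCompletion I R)) := by
    have : I.map (algebraMap R (AdicCompletion I R)) =
        (J.map φ).map (algebraMap R (AdicCompletion I R)) := by rw [hφ]
    rw [this, Ideal.map_map, Ideal.map_span, Ideal.map_span, ← Set.range_comp, ← Set.range_comp]
    congr 2
    ext1 i
    simp [← MvPolynomial.coe_X, hF]
  have := AdicCompletion.isAdicComplete_self I I.fg_of_isNoetherianRing
  rw [← hmap] at this
  have hsurj : Function.Surjective F := by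
    refine surjective_of_mk_map_comp_surjective (I := Ideal.span (Set.range MvPowerSeries.X)) F ?_
    intro y
    obtain ⟨y, rfl⟩ := Ideal.Quotient.mk_surjective y
    obtain ⟨r, hr⟩ := Ideal.Quotient.mk_surjective (AdicCompletion.evalOneₐ I y)
    refine ⟨((MvPolynomial.C r : MvPolynomial s R) : MvPowerSeries s R), ?_⟩
    rw [RingHom.comp_apply, hF, Ideal.Quotient.eq, hmap,
      ← AdicCompletion.ker_evalOneₐ_eq_map _ I.fg_of_isNoetherianRing, RingHom.mem_ker]
    simp [φ, ← hr]
  exact isNoetherianRing_of_surjective _ _ F hsurj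

section

variable {R : Type*} [CommRing R] (I : Ideal R) {B E : Type*} [AddCommGroup B] [Module R B]
  [AddCommGroup E] [Module R E]

/-- The comparison map `B ⊗[R] E → B̂ ⊗ (R̂ ⊗ E)`, where the middle tensor product is over the
completion `R̂`. -/
noncomputable def tensorToCompletionTensor :
    B ⊗[R] E →ₗ[R] AdicCompletion I B ⊗[AdicCompletion I R] (AdicCompletion I R ⊗[R] E) :=
  TensorProduct.lift <| LinearMap.mk₂ R
    (fun b e ↦ AdicCompletion.of I B b ⊗ₜ (1 ⊗ₜ e))
    (fun b b' e ↦ by rw [map_add, TensorProduct.add_tmul])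
    (fun r b e ↦ by rw [map_smul, TensorProduct.smul_tmul'])
    (fun b e e' ↦ by rw [TensorProduct.tmul_add, TensorProduct.tmul_add])
    (fun r b e ↦ by rw [TensorProduct.tmul_smul, TensorProduct.tmul_smul])

/-- If `1 ⊗ u` vanishes in `R̂ ⊗ E`, then `u` lies in `I ^ n • E` for all `n`. -/
theorem mem_pow_smul_top_of_one_tmul_eq_zero {u : E}
    (h : (1 : AdicCompletion I R) ⊗ₜ[R] u = 0) (n : ℕ) : u ∈ I ^ n • (⊤ : Submodule R E) := by
  have h' : (1 : R ⧸ I ^ n) ⊗ₜ[R] u = 0 := by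
    simpa using congrArg (LinearMap.rTensor E (AdicCompletion.evalₐ I n).toLinearMap) h
  have := congrArg (TensorProduct.quotTensorEquivQuotSMul E (I ^ n)) h'
  rw [map_zero, ← map_one (Ideal.Quotient.mk (I ^ n)),
    TensorProduct.quotTensorEquivQuotSMul_mk_tmul, one_smul] at this
  exact (Submodule.Quotient.mk_eq_zero _).mp this

variable {I}

/-- For an `R̂`-module `E` killed by `I ^ n`, vanishing of `b ⊗ u` over the completion implies
its vanishing over `R`. -/
theorem tmul_eq_zero_of_completion_tmul_eq_zero (hI : I.FG) [Module (AdicCompletion I R) E]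
    [IsScalarTower R (AdicCompletion I R) E] {n : ℕ}
    (hE : I ^ n • (⊤ : Submodule R E) = ⊥) {b : B} {u : E}
    (h : AdicCompletion.of I B b ⊗ₜ[AdicCompletion I R] u = 0) : b ⊗ₜ[R] u = 0 := by
  let g : (B ⧸ (I ^ n • ⊤ : Submodule R B)) →ₗ[R] E →ₗ[R] B ⊗[R] E :=
    Submodule.liftQ _ (TensorProduct.mk R B E) <| by
      rw [Submodule.smul_le]
      intro r hr b _
      ext e
      have : r • e = 0 := by
        rw [← Submodule.mem_bot R, ← hE]
        exact Submodule.smul_mem_smul hr trivial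
      rw [TensorProduct.mk_apply, TensorProduct.smul_tmul, this, TensorProduct.tmul_zero,
        LinearMap.zero_apply]
  let G : AdicCompletion I B →ₗ[R] E →ₗ[R] B ⊗[R] E := g ∘ₗ AdicCompletion.eval I B n
  have hker (t : AdicCompletion I R) (ht : AdicCompletion.eval I R n t = 0) (e : E) :
      t • e = 0 := by
    rw [← LinearMap.mem_ker, ← AdicCompletion.pow_smul_top_eq_ker_eval hI] at ht
    refine Submodule.smul_induction_on ht (fun r hr t _ ↦ ?_) fun t t' ht ht' ↦ ?_
    · rw [smul_assoc, ← Submodule.mem_bot R, ← hE]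
      exact Submodule.smul_mem_smul hr trivial
    · rw [add_smul, ht, ht', add_zero]
  have hG (t : AdicCompletion I R) (y : AdicCompletion I B) (e : E) :
      G (t • y) e = G y (t • e) := by
    obtain ⟨r, hr⟩ := Submodule.Quotient.mk_surjective _ (AdicCompletion.eval I R n t)
    have hte : t • e = r • e := by
      rw [← sub_eq_zero, ← algebraMap_smul (AdicCompletion I R) r e, ← sub_smul]
      exact hker _ (by rw [map_sub, ← hr, sub_eq_zero]; rfl) e
    have hty : AdicCompletion.eval I B n (t • y) = r • AdicCompletion.eval I B n y := by
      change AdicCompletion.eval I R n t • AdicCompletion.eval I B n y = _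
      rw [← hr]
      obtain ⟨b, hb⟩ := Submodule.Quotient.mk_surjective _ (AdicCompletion.eval I B n y)
      rw [← hb]
      rfl
    rw [hte]
    simp only [G, LinearMap.comp_apply, hty, map_smul, LinearMap.smul_apply]
  let L : AdicCompletion I B ⊗[AdicCompletion I R] E →+ B ⊗[R] E :=
    TensorProduct.liftAddHom
      (LinearMap.toAddMonoidHom'.comp G.toAddMonoidHom) hG
  exact (congrArg L h).trans (map_zero L)

end

/-- Let `(R, 𝔪)` be a Noetherian local ring whose residue field has characteristic `p > 0`,
`B` an `R`-algebra and `x ∈ B`.  Then the `R`-module map `R → B`, `1 ↦ x`, is pure if and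
only if the induced map `R̂ → B̂` between the `𝔪`-adic completions, sending `1` to the image
of `x`, is a pure map of `R̂`-modules. -/
theorem pure_along_iff_completion_pure_along
    (p : ℕ) (hp : p.Prime) (R : Type u) [CommRing R] [IsNoetherianRing R] [IsLocalRing R]
    [CharP (IsLocalRing.ResidueField R) p]
    (B : Type u) [CommRing B] [Algebra R B] (x : B) :
    IsPureMap R (LinearMap.toSpanSingleton R B x) ↔
      IsPureMap (AdicCompletion (IsLocalRing.maximalIdeal R) R)
        (AdicCompletion.map (IsLocalRing.maximalIdeal R)
          (LinearMap.toSpanSingleton R B x)) := by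
  have hfg : (maximalIdeal R).FG := (maximalIdeal R).fg_of_isNoetherianRing
  have hmap : AdicCompletion.map (maximalIdeal R) (LinearMap.toSpanSingleton R B x) 1 =
      AdicCompletion.of (maximalIdeal R) B x := by
    change AdicCompletion.map (maximalIdeal R) (LinearMap.toSpanSingleton R B x)
      (AdicCompletion.of (maximalIdeal R) R 1) = _
    rw [AdicCompletion.map_of, LinearMap.toSpanSingleton_apply, one_smul]
  constructor
  · intro h
    rw [isPureMap_iff_tmul_eq_zero] at h
    refine isPureMap_of_pow_maximalIdeal_smul_eq_bot _ fun E _ _ n hE u hu ↦ ?_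
    let _ : Module R E := Module.compHom E (algebraMap R (AdicCompletion (maximalIdeal R) R))
    have : IsScalarTower R (AdicCompletion (maximalIdeal R) R) E :=
      IsScalarTower.of_algebraMap_smul fun _ _ ↦ rfl
    replace hu := (congrArg (· ⊗ₜ[AdicCompletion (maximalIdeal R) R] u) hmap).symm.trans hu
    refine h E u ?_
    rw [LinearMap.toSpanSingleton_apply, one_smul]
    refine tmul_eq_zero_of_completion_tmul_eq_zero (n := n) hfg ?_ hu
    rw [eq_bot_iff, Submodule.smul_le]
    intro r hr e _
    rw [Submodule.mem_bot, ← algebraMap_smul (AdicCompletion (maximalIdeal R) R) r e,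
      ← Submodule.mem_bot (AdicCompletion (maximalIdeal R) R), ← hE,
      AdicCompletion.maximalIdeal_eq_map, ← Ideal.map_pow]
    exact Submodule.smul_mem_smul (Ideal.mem_map_of_mem _ hr) trivial
  · intro h
    replace h := (isPureMap_iff_tmul_eq_zero _).mp h
    refine isPureMap_of_pow_maximalIdeal_smul_eq_bot _ fun E _ _ n hE u hu ↦ ?_
    rw [LinearMap.toSpanSingleton_apply, one_smul] at hu
    rw [← Submodule.mem_bot R, ← hE]
    refine mem_pow_smul_top_of_one_tmul_eq_zero _ (h _ _ ?_) n
    refine (congrArg (· ⊗ₜ[AdicCompletion (maximalIdeal R) R] _) hmap).trans ?_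
    exact (congrArg (tensorToCompletionTensor (maximalIdeal R)) hu).trans (map_zero _)
end
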